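/- A projective 16-divisible binary linear code C of effective length 131 does not contain a codeword of Hamming weight 16 or of Hamming weight 32. -/

import Mathlib

/-- Hamming weight of a binary vector. -/
def hwt {n : ℕ} (c : Fin n → ZMod 2) : ℕ :=
  (Finset.univ.filter fun i => c i ≠ 0).card

set_option linter.unusedVariables false
open Classical in
/-- The codewords as a finset. -/
noncomputable def cs (C : Submodule (ZMod 2) (Fin 131 → ZMod 2)) :
    Finset (Fin 131 → ZMod 2) := Finset.univ.filter (fun x => x ∈ C)

def sg (z : ZMod 2) : ℤ := if z = 0 then 1 else -1
def uu (z : ZMod 2) : ℤ := if z = 0 then 0 else 1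

def W (x : Fin 131 → ZMod 2) : ℤ := ∑ i, uu (x i)
def O (x c : Fin 131 → ZMod 2) : ℤ := ∑ i, uu (x i) * uu (c i)
def SS (x : Fin 131 → ZMod 2) : ℤ := ∑ i, sg (x i)
noncomputable def NN (C : Submodule (ZMod 2) (Fin 131 → ZMod 2)) : ℤ := ((cs C).card : ℤ)

theorem mem_cs {C : Submodule (ZMod 2) (Fin 131 → ZMod 2)} {x} : x ∈ cs C ↔ x ∈ C := by
  simp [cs]

attribute [irreducible] cs

theorem sg_add : ∀ a b : ZMod 2, sg (a + b) = sg a * sg b := by decide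
theorem sg_sq : ∀ a : ZMod 2, sg a * sg a = 1 := by decide
theorem sg_eq : ∀ a : ZMod 2, sg a = 1 - 2 * uu a := by decide
theorem sg_mul_ne : ∀ a b : ZMod 2, a ≠ b → sg a * sg b = -1 := by decide
theorem sg_ne : ∀ a : ZMod 2, a ≠ 0 → sg a = -1 := by decide
theorem sg_cases : ∀ a : ZMod 2, sg a = 1 ∨ sg a = -1 := by decide
theorem uu_add : ∀ a b : ZMod 2, uu (a + b) = uu a + uu b - 2 * (uu a * uu b) := by decide
theorem uu_nonneg : ∀ a : ZMod 2, 0 ≤ uu a := by decide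
theorem uu_le : ∀ a : ZMod 2, uu a ≤ 1 := by decide
theorem uu_zero : uu 0 = 0 := by decide
theorem add_self2 (c : Fin 131 → ZMod 2) : c + c = 0 := by
  funext i
  exact (by decide : ∀ a : ZMod 2, a + a = 0) (c i)
theorem add_add2 (x c : Fin 131 → ZMod 2) : x + c + c = x := by
  rw [add_assoc, add_self2, add_zero]
theorem add_eq_zero2 {x c : Fin 131 → ZMod 2} (h : x + c = 0) : x = c := by
  rw [← add_add2 x c, h, zero_add]

theorem hwt_eq (x : Fin 131 → ZMod 2) : (hwt x : ℤ) = W x := by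
  unfold hwt W uu
  rw [Finset.card_filter]
  push_cast
  refine Finset.sum_congr rfl fun i _ => ?_
  by_cases h : x i = 0 <;> simp [h]

theorem SS_eq (x : Fin 131 → ZMod 2) : SS x = 131 - 2 * W x := by
  unfold SS W
  simp only [sg_eq, Finset.sum_sub_distrib, ← Finset.mul_sum]
  simp

theorem W_add (x c : Fin 131 → ZMod 2) : W (x + c) = W x + W c - 2 * O x c := by
  unfold W O
  simp only [Pi.add_apply, uu_add, Finset.sum_add_distrib, Finset.sum_sub_distrib, ← Finset.mul_sum]

theorem W_zero : W 0 = 0 := by simp [W, uu_zero]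
theorem W_nonneg (x) : 0 ≤ W x := Finset.sum_nonneg fun i _ => uu_nonneg _
theorem W_eq_zero {x} (h : W x = 0) : x = 0 := by
  unfold W at h
  rw [Finset.sum_eq_zero_iff_of_nonneg (fun i _ => uu_nonneg _)] at h
  funext i
  exact (by decide : ∀ a : ZMod 2, uu a = 0 → a = 0) _ (h i (Finset.mem_univ i))
theorem O_nonneg (x c) : 0 ≤ O x c :=
  Finset.sum_nonneg fun i _ => mul_nonneg (uu_nonneg _) (uu_nonneg _)
theorem O_le (x c) : O x c ≤ W c :=
  Finset.sum_le_sum fun i _ => (by decide : ∀ a b : ZMod 2, uu a * uu b ≤ uu b) _ _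
theorem O_le' (x c) : O x c ≤ W x :=
  Finset.sum_le_sum fun i _ => (by decide : ∀ a b : ZMod 2, uu a * uu b ≤ uu a) _ _
theorem O_comm (x c) : O x c = O c x :=
  Finset.sum_congr rfl fun i _ => mul_comm _ _
theorem O_self (c) : O c c = W c :=
  Finset.sum_congr rfl fun i _ => (by decide : ∀ a : ZMod 2, uu a * uu a = uu a) _
theorem O_zero (c) : O 0 c = 0 := by simp [O, uu_zero]
theorem O_add_self (x c) : O (x + c) c = W c - O x c := by
  unfold O W
  rw [← Finset.sum_sub_distrib]
  exact Finset.sum_congr rfl fun i _ =>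
    (by decide : ∀ a b : ZMod 2, uu (a + b) * uu b = uu b - uu a * uu b) _ _

section
variable {C : Submodule (ZMod 2) (Fin 131 → ZMod 2)}

theorem sum_trans {a : Fin 131 → ZMod 2} (ha : a ∈ C) (f : (Fin 131 → ZMod 2) → ℤ) :
    ∑ x ∈ cs C, f (x + a) = ∑ x ∈ cs C, f x := by
  refine Finset.sum_nbij' (fun x => x + a) (fun x => x + a) ?_ ?_ ?_ ?_ ?_
  · intro x hx; exact mem_cs.2 (C.add_mem (mem_cs.1 hx) ha)
  · intro x hx; exact mem_cs.2 (C.add_mem (mem_cs.1 hx) ha)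
  · intro x _; exact add_add2 x a
  · intro x _; exact add_add2 x a
  · intro x _; rfl

theorem char_zero (f : (Fin 131 → ZMod 2) → ℤ) (hf : ∀ x a, f (x + a) = f x * f a)
    {a : Fin 131 → ZMod 2} (ha : a ∈ C) (h : f a = -1) : ∑ x ∈ cs C, f x = 0 := by
  have := sum_trans ha f
  simp only [hf, h, ← Finset.sum_mul] at this
  linarith

theorem card_pow (C : Submodule (ZMod 2) (Fin 131 → ZMod 2)) : ∃ k : ℕ, (cs C).card = 2 ^ k := by
  classical
  refine ⟨Module.finrank (ZMod 2) C, ?_⟩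
  have h := Module.card_eq_pow_finrank (K := ZMod 2) (V := C)
  rw [ZMod.card] at h
  rw [← h, Fintype.card_subtype]
  unfold cs
  congr

theorem sum_s (heff : ∀ i : Fin 131, ∃ c ∈ C, c i ≠ 0) (i) : ∑ x ∈ cs C, sg (x i) = 0 := by
  obtain ⟨c, hc, h⟩ := heff i
  exact char_zero (fun x => sg (x i)) (fun x a => sg_add _ _) hc (sg_ne _ h)

theorem sum_ss (hproj : ∀ i j : Fin 131, i ≠ j → ∃ c ∈ C, c i ≠ c j) (i j) :
    ∑ x ∈ cs C, sg (x i) * sg (x j) = if i = j then NN C else 0 := by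
  split_ifs with hij
  · subst hij
    simp [sg_sq, NN]
  · obtain ⟨c, hc, h⟩ := hproj i j hij
    refine char_zero (fun x => sg (x i) * sg (x j)) (fun x a => ?_) hc (sg_mul_ne _ _ h)
    simp only [Pi.add_apply, sg_add]; ring

theorem sum_sss (i j k : Fin 131) : 0 ≤ ∑ x ∈ cs C, sg (x i) * (sg (x j) * sg (x k)) := by
  by_cases h : ∃ c ∈ C, sg (c i) * (sg (c j) * sg (c k)) = -1
  · obtain ⟨c, hc, h⟩ := h
    refine (char_zero (fun x => sg (x i) * (sg (x j) * sg (x k))) (fun x a => ?_) hc h).ge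
    simp only [Pi.add_apply, sg_add]; ring
  · push Not at h
    refine Finset.sum_nonneg fun x hx => ?_
    have := h x (mem_cs.1 hx)
    rcases sg_cases (x i) with h1 | h1 <;> rcases sg_cases (x j) with h2 | h2 <;>
      rcases sg_cases (x k) with h3 | h3 <;> rw [h1, h2, h3] at this ⊢ <;> simp_all

theorem sum_A1 (heff : ∀ i : Fin 131, ∃ c ∈ C, c i ≠ 0) (A : Finset (Fin 131)) :
    ∑ x ∈ cs C, ∑ i ∈ A, sg (x i) = 0 := by
  rw [Finset.sum_comm]
  exact Finset.sum_eq_zero fun i _ => sum_s heff i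

theorem sum_A2 (hproj : ∀ i j : Fin 131, i ≠ j → ∃ c ∈ C, c i ≠ c j) (A : Finset (Fin 131)) :
    ∑ x ∈ cs C, (∑ i ∈ A, sg (x i)) ^ 2 = A.card * NN C := by
  simp only [pow_two, Finset.sum_mul_sum]
  rw [Finset.sum_comm]
  have : ∀ i ∈ A, ∑ x ∈ cs C, ∑ j ∈ A, sg (x i) * sg (x j) = NN C := by
    intro i hi
    rw [Finset.sum_comm]
    simp only [sum_ss hproj]
    simp [hi]
  rw [Finset.sum_congr rfl this]
  simp

theorem sum_P1 (hproj : ∀ i j : Fin 131, i ≠ j → ∃ c ∈ C, c i ≠ c j) (P) :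
    ∑ x ∈ cs C, sg (x P) * SS x = NN C := by
  unfold SS
  simp only [Finset.mul_sum]
  rw [Finset.sum_comm]
  simp only [sum_ss hproj]
  simp

theorem sum_P2 (P) : 0 ≤ ∑ x ∈ cs C, sg (x P) * SS x ^ 2 := by
  unfold SS
  simp only [pow_two, Finset.sum_mul_sum]
  simp only [Finset.mul_sum]
  rw [Finset.sum_comm]
  refine Finset.sum_nonneg fun i _ => ?_
  rw [Finset.sum_comm]
  exact Finset.sum_nonneg fun j _ => sum_sss _ _ _

theorem sum_S3 : 0 ≤ ∑ x ∈ cs C, SS x ^ 3 := by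
  have : ∀ x, SS x ^ 3 = ∑ P, sg (x P) * SS x ^ 2 := by
    intro x
    rw [← Finset.sum_mul]
    change _ = SS x * _
    ring
  simp only [this]
  rw [Finset.sum_comm]
  exact Finset.sum_nonneg fun P _ => sum_P2 P

theorem W16 (hdiv : ∀ c ∈ C, 16 ∣ hwt c) {x} (hx : x ∈ C) : (16 : ℤ) ∣ W x := by
  rw [← hwt_eq]; exact_mod_cast hdiv x hx

theorem O8 (hdiv : ∀ c ∈ C, 16 ∣ hwt c) {x c} (hx : x ∈ C) (hc : c ∈ C) : (8 : ℤ) ∣ O x c := by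
  have h1 := W16 hdiv hx
  have h2 := W16 hdiv hc
  have h3 := W16 hdiv (C.add_mem hx hc)
  rw [W_add] at h3
  omega

theorem NN_pos : 0 < NN C := by
  unfold NN
  have : 0 < (cs C).card := Finset.card_pos.2 ⟨0, mem_cs.2 C.zero_mem⟩
  exact_mod_cast this

theorem W_le (heff : ∀ i : Fin 131, ∃ c ∈ C, c i ≠ 0)
    (hproj : ∀ i j : Fin 131, i ≠ j → ∃ c ∈ C, c i ≠ c j)
    (hdiv : ∀ c ∈ C, 16 ∣ hwt c) {c} (hc : c ∈ C) : W c ≤ 80 := by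
  set A : Finset (Fin 131) := Finset.univ.filter fun i => c i = 0 with hA
  have hAc : (A.card : ℤ) = 131 - W c := by
    have : (131 : ℤ) = ∑ i : Fin 131, 1 := by simp
    rw [this, W, ← Finset.sum_sub_distrib, hA, Finset.card_filter]
    push_cast
    refine Finset.sum_congr rfl fun i _ => ?_
    unfold uu
    by_cases h : c i = 0 <;> simp [h]
  have hS : ∀ x, ∑ i ∈ A, sg (x i) = A.card - 2 * (W x - O x c) := by
    intro x
    rw [hAc, hA, Finset.sum_filter]
    have : (131 : ℤ) = ∑ i : Fin 131, 1 := by simp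
    rw [this]
    unfold W O
    rw [← Finset.sum_sub_distrib, ← Finset.sum_sub_distrib, Finset.mul_sum, ← Finset.sum_sub_distrib]
    refine Finset.sum_congr rfl fun i _ => ?_
    generalize x i = a
    generalize c i = b
    revert a b
    decide
  have h1 := sum_A1 heff A
  have h2 := sum_A2 hproj A
  have h0 : 0 ≤ ∑ x ∈ cs C, ((∑ i ∈ A, sg (x i)) ^ 2 + 10 * (∑ i ∈ A, sg (x i)) - 39) := by
    refine Finset.sum_nonneg fun x hx => ?_
    rw [hS]
    have hx := mem_cs.1 hx
    obtain ⟨a, ha⟩ := W16 hdiv hx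
    obtain ⟨b, hb⟩ := W16 hdiv hc
    obtain ⟨d, hd⟩ := O8 hdiv hx hc
    rw [hAc, ha, hb, hd]
    have : (131 - 16 * b - 2 * (16 * a - 8 * d)) ^ 2 + 10 * (131 - 16 * b - 2 * (16 * a - 8 * d)) - 39
      = 256 * ((8 - b - 2 * a + d) * ((8 - b - 2 * a + d) + 1)) := by ring
    rw [this]
    have : 0 ≤ (8 - b - 2 * a + d) * ((8 - b - 2 * a + d) + 1) := by
      rcases le_or_gt 0 (8 - b - 2 * a + d) with h | h
      · positivity
      · exact mul_nonneg_of_nonpos_of_nonpos h.le h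
    positivity
  rw [Finset.sum_sub_distrib, Finset.sum_add_distrib, ← Finset.mul_sum, h1, h2] at h0
  simp only [Finset.sum_const, nsmul_eq_mul] at h0
  change 0 ≤ (A.card : ℤ) * NN C + 10 * 0 - NN C * 39 at h0
  have h3 : 0 ≤ ((A.card : ℤ) - 39) * NN C := by linarith
  have h4 := nonneg_of_mul_nonneg_left h3 NN_pos
  have := W16 hdiv hc
  omega

def FF (x : Fin 131 → ZMod 2) : ℤ :=
  if W x = 0 then 10 else if W x = 16 then 6 else if W x = 32 then 3 else if W x = 48 then 1 else 0
def GG (x : Fin 131 → ZMod 2) : ℤ :=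
  if W x = 0 then 10 else if W x = 16 then 4 else if W x = 32 then 1 else 0

theorem W_cases (heff : ∀ i : Fin 131, ∃ c ∈ C, c i ≠ 0)
    (hproj : ∀ i j : Fin 131, i ≠ j → ∃ c ∈ C, c i ≠ c j)
    (hdiv : ∀ c ∈ C, 16 ∣ hwt c) {c} (hc : c ∈ C) :
    W c = 0 ∨ W c = 16 ∨ W c = 32 ∨ W c = 48 ∨ W c = 64 ∨ W c = 80 := by
  have := W_le heff hproj hdiv hc
  have := W16 hdiv hc
  have := W_nonneg c
  omega

theorem FF_eq {x} (h : W x = 0 ∨ W x = 16 ∨ W x = 32 ∨ W x = 48 ∨ W x = 64 ∨ W x = 80) :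
    2048 * FF x = SS x ^ 2 + 26 * SS x - 87 := by
  rw [SS_eq]; unfold FF
  rcases h with h | h | h | h | h | h <;> rw [h] <;> norm_num

theorem GG_eq {x} (h : W x = 0 ∨ W x = 16 ∨ W x = 32 ∨ W x = 48 ∨ W x = 64 ∨ W x = 80) :
    196608 * GG x = SS x ^ 3 - 9 * SS x ^ 2 - 997 * SS x + 3045 := by
  rw [SS_eq]; unfold GG
  rcases h with h | h | h | h | h | h <;> rw [h] <;> norm_num

theorem sum_F (heff : ∀ i : Fin 131, ∃ c ∈ C, c i ≠ 0)
    (hproj : ∀ i j : Fin 131, i ≠ j → ∃ c ∈ C, c i ≠ c j)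
    (hdiv : ∀ c ∈ C, 16 ∣ hwt c) : 512 * ∑ x ∈ cs C, FF x = 11 * NN C := by
  have h : 2048 * ∑ x ∈ cs C, FF x = ∑ x ∈ cs C, (SS x ^ 2 + 26 * SS x - 87) := by
    rw [Finset.mul_sum]
    exact Finset.sum_congr rfl fun x hx => FF_eq (W_cases heff hproj hdiv (mem_cs.1 hx))
  have h1 : ∑ x ∈ cs C, SS x = 0 := sum_A1 heff Finset.univ
  have h2 : ∑ x ∈ cs C, SS x ^ 2 = 131 * NN C := by
    have := sum_A2 hproj Finset.univ
    simpa [SS] using this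
  rw [Finset.sum_sub_distrib, Finset.sum_add_distrib, ← Finset.mul_sum, h1, h2] at h
  simp only [Finset.sum_const, nsmul_eq_mul] at h
  change _ = _ - NN C * 87 at h
  linarith

theorem sum_G (heff : ∀ i : Fin 131, ∃ c ∈ C, c i ≠ 0)
    (hproj : ∀ i j : Fin 131, i ≠ j → ∃ c ∈ C, c i ≠ c j)
    (hdiv : ∀ c ∈ C, 16 ∣ hwt c) : 311 * NN C ≤ 32768 * ∑ x ∈ cs C, GG x := by
  have h : 196608 * ∑ x ∈ cs C, GG x =
      ∑ x ∈ cs C, (SS x ^ 3 - 9 * SS x ^ 2 - 997 * SS x + 3045) := by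
    rw [Finset.mul_sum]
    exact Finset.sum_congr rfl fun x hx => GG_eq (W_cases heff hproj hdiv (mem_cs.1 hx))
  have h1 : ∑ x ∈ cs C, SS x = 0 := sum_A1 heff Finset.univ
  have h2 : ∑ x ∈ cs C, SS x ^ 2 = 131 * NN C := by
    have := sum_A2 hproj Finset.univ
    simpa [SS] using this
  have h3 := sum_S3 (C := C)
  rw [Finset.sum_add_distrib, Finset.sum_sub_distrib, Finset.sum_sub_distrib, ← Finset.mul_sum,
    ← Finset.mul_sum, h1, h2] at h
  simp only [Finset.sum_const, nsmul_eq_mul] at h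
  change _ = _ + NN C * 3045 at h
  linarith

theorem cover (heff : ∀ i : Fin 131, ∃ c ∈ C, c i ≠ 0)
    (hproj : ∀ i j : Fin 131, i ≠ j → ∃ c ∈ C, c i ≠ c j)
    (hdiv : ∀ c ∈ C, 16 ∣ hwt c) (P) : 2048 * ∑ x ∈ cs C, FF x * uu (x P) ≤ 9 * NN C := by
  have h : 2048 * ∑ x ∈ cs C, FF x * sg (x P) =
      ∑ x ∈ cs C, (sg (x P) * SS x ^ 2 + 26 * (sg (x P) * SS x) - 87 * sg (x P)) := by
    rw [Finset.mul_sum]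
    refine Finset.sum_congr rfl fun x hx => ?_
    rw [← mul_assoc, FF_eq (W_cases heff hproj hdiv (mem_cs.1 hx))]
    ring
  rw [Finset.sum_sub_distrib, Finset.sum_add_distrib, ← Finset.mul_sum,
    ← Finset.mul_sum, sum_s heff, sum_P1 hproj] at h
  have h2 := sum_P2 (C := C) P
  have h3 : ∑ x ∈ cs C, FF x * sg (x P) = ∑ x ∈ cs C, FF x - 2 * ∑ x ∈ cs C, FF x * uu (x P) := by
    rw [Finset.mul_sum, ← Finset.sum_sub_distrib]
    refine Finset.sum_congr rfl fun x _ => ?_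
    rw [sg_eq]; ring
  have h4 := sum_F heff hproj hdiv
  linarith

theorem sum_FO (c : Fin 131 → ZMod 2) :
    ∑ x ∈ cs C, FF x * O x c = ∑ P, uu (c P) * ∑ x ∈ cs C, FF x * uu (x P) := by
  unfold O
  simp only [Finset.mul_sum]
  rw [Finset.sum_comm]
  exact Finset.sum_congr rfl fun P _ => Finset.sum_congr rfl fun x _ => by ring

theorem FO_le (heff : ∀ i : Fin 131, ∃ c ∈ C, c i ≠ 0)
    (hproj : ∀ i j : Fin 131, i ≠ j → ∃ c ∈ C, c i ≠ c j)
    (hdiv : ∀ c ∈ C, 16 ∣ hwt c) (c : Fin 131 → ZMod 2) :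
    2048 * ∑ x ∈ cs C, FF x * O x c ≤ 9 * NN C * W c := by
  rw [sum_FO, Finset.mul_sum, W, Finset.mul_sum]
  refine Finset.sum_le_sum fun P _ => ?_
  have := mul_le_mul_of_nonneg_left (cover heff hproj hdiv P) (uu_nonneg (c P))
  linarith

theorem FF_nonneg (x) : 0 ≤ FF x := by unfold FF; split_ifs <;> norm_num

theorem no16 (heff : ∀ i : Fin 131, ∃ c ∈ C, c i ≠ 0)
    (hproj : ∀ i j : Fin 131, i ≠ j → ∃ c ∈ C, c i ≠ c j)
    (hdiv : ∀ c ∈ C, 16 ∣ hwt c) {c} (hc : c ∈ C) : W c ≠ 16 := by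
  intro hw
  have h1 := FO_le heff hproj hdiv c
  have h2 := sum_G heff hproj hdiv
  rw [hw] at h1
  have h3 : 96 ≤ ∑ x ∈ cs C, FF x * O x c := by
    have := Finset.single_le_sum (f := fun x => FF x * O x c)
      (fun x _ => mul_nonneg (FF_nonneg x) (O_nonneg x c)) (mem_cs.2 hc)
    simp only [O_self, hw] at this
    have hf : FF c = 6 := by unfold FF; rw [hw]; norm_num
    rw [hf] at this
    linarith
  have hc0 : c ≠ 0 := by
    rintro rfl
    rw [W_zero] at hw
    norm_num at hw
  classical
  have h5 : ∑ x ∈ cs C, ((if x = 0 then (-192 : ℤ) else 0) + (if x = c then -192 else 0)) ≤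
      ∑ x ∈ cs C, ((5 * (FF x * O x c) - 48 * GG x)
        + (5 * (FF (x + c) * O (x + c) c) - 48 * GG (x + c))) := by
    refine Finset.sum_le_sum fun x hx => ?_
    have hx := mem_cs.1 hx
    have a1 := W_cases heff hproj hdiv hx
    have a2 := W_cases heff hproj hdiv (C.add_mem hx hc)
    have a3 := W_add x c
    have a4 := O_add_self x c
    rw [hw] at a3 a4
    have a5 := O_nonneg x c
    have a6 := O_le x c
    rw [hw] at a6
    by_cases e0 : x = 0
    · subst e0
      rw [if_pos rfl, if_neg hc0.symm]
      unfold FF GG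
      simp [W_zero, O_zero, hw, O_self]
    rw [if_neg e0]
    by_cases ec : x = c
    · subst ec
      rw [if_pos rfl]
      unfold FF GG
      simp [W_zero, O_zero, hw, O_self, add_self2]
    rw [if_neg ec]
    have b1 : W x ≠ 0 := fun h => e0 (W_eq_zero h)
    have b2 : W (x + c) ≠ 0 := fun h => ec (add_eq_zero2 (W_eq_zero h))
    rw [a4]
    unfold FF GG
    rw [a3] at a2 b2 ⊢
    generalize O x c = o at *
    generalize W x = w at *
    rcases a1 with rfl | rfl | rfl | rfl | rfl | rfl <;>
    rcases a2 with h | h | h | h | h | h <;> simp only [h] <;> norm_num at * <;> omega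
  rw [Finset.sum_add_distrib, Finset.sum_add_distrib,
    sum_trans hc (fun x => 5 * (FF x * O x c) - 48 * GG x), Finset.sum_sub_distrib,
    ← Finset.mul_sum, ← Finset.mul_sum, Finset.sum_ite_eq', Finset.sum_ite_eq',
    if_pos (mem_cs.2 C.zero_mem), if_pos (mem_cs.2 hc)] at h5
  obtain ⟨k, hk⟩ := card_pow C
  have hN : NN C = 2 ^ k := by unfold NN; rw [hk]; norm_cast
  have hl : 1366 ≤ NN C := by linarith
  have hu : NN C ≤ 1847 := by linarith
  rw [hN] at hl hu
  have k1 : k < 11 := by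
    by_contra h
    have : (2 : ℤ) ^ 11 ≤ 2 ^ k := pow_le_pow_right₀ (by norm_num) (by omega)
    norm_num at this; linarith
  have : (2 : ℤ) ^ k ≤ 2 ^ 10 := pow_le_pow_right₀ (by norm_num) (by omega)
  norm_num at this; linarith

end

theorem O_add_le (a b c : Fin 131 → ZMod 2) : O (a + b) c ≤ O a c + O b c := by
  unfold O
  rw [← Finset.sum_add_distrib]
  exact Finset.sum_le_sum fun i _ =>
    (by decide : ∀ a b c : ZMod 2, uu (a + b) * uu c ≤ uu a * uu c + uu b * uu c) _ _ _

theorem O_eq_zero {x c : Fin 131 → ZMod 2} : O x c = 0 ↔ ∀ i, c i ≠ 0 → x i = 0 := by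
  unfold O
  rw [Finset.sum_eq_zero_iff_of_nonneg (fun i _ => mul_nonneg (uu_nonneg _) (uu_nonneg _))]
  constructor
  · intro h i hi
    exact (by decide : ∀ a b : ZMod 2, uu a * uu b = 0 → b ≠ 0 → a = 0) _ _ (h i (Finset.mem_univ i)) hi
  · intro h i _
    exact (by decide : ∀ a b : ZMod 2, (b ≠ 0 → a = 0) → uu a * uu b = 0) _ _ (h i)

/-- words of weight w -/
noncomputable def Sw (C : Submodule (ZMod 2) (Fin 131 → ZMod 2)) (w : ℤ) :
    Finset (Fin 131 → ZMod 2) := (cs C).filter (fun x => W x = w)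

theorem mem_Sw {C : Submodule (ZMod 2) (Fin 131 → ZMod 2)} {w : ℤ} {x} :
    x ∈ Sw C w ↔ x ∈ C ∧ W x = w := by
  simp [Sw, mem_cs]

attribute [irreducible] Sw

section
variable {C : Submodule (ZMod 2) (Fin 131 → ZMod 2)}

theorem sum_Sw (w : ℤ) (f : (Fin 131 → ZMod 2) → ℤ) :
    ∑ x ∈ Sw C w, f x = ∑ x ∈ cs C, if W x = w then f x else 0 := by
  unfold Sw
  rw [Finset.sum_filter]

theorem decomp (hn : ∀ x ∈ C, W x ≠ 16) (f : (Fin 131 → ZMod 2) → ℤ) :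
    ∑ x ∈ cs C, FF x * f x = 10 * f 0 + 3 * ∑ x ∈ Sw C 32, f x + ∑ x ∈ Sw C 48, f x := by
  classical
  have h0 : 10 * f 0 = ∑ x ∈ cs C, if x = 0 then 10 * f x else 0 := by
    rw [Finset.sum_ite_eq', if_pos (mem_cs.2 C.zero_mem)]
  rw [h0, sum_Sw, sum_Sw, Finset.mul_sum, ← Finset.sum_add_distrib, ← Finset.sum_add_distrib]
  refine Finset.sum_congr rfl fun x hx => ?_
  have h1 := hn x (mem_cs.1 hx)
  by_cases e : x = 0
  · subst e
    simp [FF, W_zero]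
  · have h2 : W x ≠ 0 := fun h => e (W_eq_zero h)
    unfold FF
    rw [if_neg h2, if_neg h1, if_neg e]
    by_cases h3 : W x = 32
    · simp [h3]
    · by_cases h4 : W x = 48
      · simp [h4]
      · simp [h3, h4]

theorem sumG (hn : ∀ x ∈ C, W x ≠ 16) :
    ∑ x ∈ cs C, GG x = 10 + (Sw C 32).card := by
  classical
  have h0 : (10 : ℤ) = ∑ x ∈ cs C, if x = 0 then 10 else 0 := by
    rw [Finset.sum_ite_eq', if_pos (mem_cs.2 C.zero_mem)]
  have h1 : ((Sw C 32).card : ℤ) = ∑ x ∈ Sw C 32, 1 := by simp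
  rw [h0, h1, sum_Sw, ← Finset.sum_add_distrib]
  refine Finset.sum_congr rfl fun x hx => ?_
  have h1 := hn x (mem_cs.1 hx)
  by_cases e : x = 0
  · subst e
    simp [GG, W_zero]
  · have h2 : W x ≠ 0 := fun h => e (W_eq_zero h)
    unfold GG
    rw [if_neg h2, if_neg h1, if_neg e]
    simp

theorem sum_uu_W (w : ℤ) : ∑ P, ∑ x ∈ Sw C w, uu (x P) = w * (Sw C w).card := by
  rw [Finset.sum_comm]
  have : ∀ x ∈ Sw C w, ∑ P, uu (x P) = w := fun x hx => (mem_Sw.1 hx).2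
  rw [Finset.sum_congr rfl this]
  simp [mul_comm]

theorem sum_uu_O (w : ℤ) (c : Fin 131 → ZMod 2) :
    ∑ P, uu (c P) * ∑ x ∈ Sw C w, uu (x P) = ∑ x ∈ Sw C w, O x c := by
  simp only [Finset.mul_sum]
  rw [Finset.sum_comm]
  refine Finset.sum_congr rfl fun x _ => ?_
  unfold O
  exact Finset.sum_congr rfl fun P _ => mul_comm _ _

theorem case1 (hW : ∀ x ∈ C, W x ≤ 80) (h8 : ∀ x ∈ C, ∀ c ∈ C, (8 : ℤ) ∣ O x c)
    (hA : 3 * ((Sw C 32).card : ℤ) + (Sw C 48).card = 12)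
    (hcov : ∀ P, 3 * ∑ x ∈ Sw C 32, uu (x P) + ∑ x ∈ Sw C 48, uu (x P) ≤ 4) : False := by
  classical
  have htot : 96 * ((Sw C 32).card : ℤ) + 48 * (Sw C 48).card ≤ 524 := by
    have := Finset.sum_le_sum (s := Finset.univ) fun P _ => hcov P
    rw [Finset.sum_add_distrib, ← Finset.mul_sum, sum_uu_W, sum_uu_W] at this
    simp at this
    linarith
  have hdisj : ∀ x ∈ Sw C 32, ∀ y ∈ Sw C 32, x ≠ y → O x y = 0 := by
    intro x hx y hy hxy
    rw [O_eq_zero]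
    intro P hP
    by_contra hP'
    have h1 : ∑ z ∈ ({x, y} : Finset _), uu (z P) ≤ ∑ z ∈ Sw C 32, uu (z P) := by
      refine Finset.sum_le_sum_of_subset_of_nonneg ?_ fun z _ _ => uu_nonneg _
      intro z hz
      simp only [Finset.mem_insert, Finset.mem_singleton] at hz
      rcases hz with rfl | rfl <;> assumption
    rw [Finset.sum_pair hxy] at h1
    have h2 : 0 ≤ ∑ x ∈ Sw C 48, uu (x P) := Finset.sum_nonneg fun z _ => uu_nonneg _
    have h3 : uu (x P) = 1 := by unfold uu; rw [if_neg hP']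
    have h4 : uu (y P) = 1 := by unfold uu; rw [if_neg hP]
    have := hcov P
    omega
  have hle : (Sw C 32).card ≤ 2 := by
    by_contra h
    push Not at h
    obtain ⟨a, b, c, ha, hb, hc, hab, hac, hbc⟩ := Finset.two_lt_card_iff.1 h
    have h1 := hdisj a ha b hb hab
    have h2 := hdisj a ha c hc hac
    have h3 := hdisj b hb c hc hbc
    have h4 := O_add_le a b c
    have h5 := W_add (a + b) c
    have h6 := W_add a b
    rw [mem_Sw] at ha hb hc
    have h7 := hW _ (C.add_mem (C.add_mem ha.1 hb.1) hc.1)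
    omega
  have h2 : (Sw C 32).card = 2 := by omega
  have h6 : ((Sw C 48).card : ℤ) = 6 := by omega
  obtain ⟨c, d, hcd, hS⟩ := Finset.card_eq_two.1 h2
  have hc : c ∈ Sw C 32 := by rw [hS]; simp
  have hd : d ∈ Sw C 32 := by rw [hS]; simp
  have key : ∀ e ∈ Sw C 32, 96 + ∑ y ∈ Sw C 48, O y e ≤ 128 := by
    intro e he
    have h := Finset.sum_le_sum (s := Finset.univ) fun P _ =>
      mul_le_mul_of_nonneg_left (hcov P) (uu_nonneg (e P))
    have h1 : ∑ P, uu (e P) * (3 * ∑ x ∈ Sw C 32, uu (x P) + ∑ x ∈ Sw C 48, uu (x P))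
        = 3 * ∑ x ∈ Sw C 32, O x e + ∑ x ∈ Sw C 48, O x e := by
      rw [← sum_uu_O, ← sum_uu_O, Finset.mul_sum, ← Finset.sum_add_distrib]
      exact Finset.sum_congr rfl fun P _ => by ring
    rw [h1, ← Finset.sum_mul] at h
    change _ ≤ W e * 4 at h
    rw [(mem_Sw.1 he).2] at h
    have h3 := Finset.single_le_sum (f := fun x => O x e) (fun x _ => O_nonneg x e) he
    simp only [O_self, (mem_Sw.1 he).2] at h3
    linarith
  have kc := key c hc
  have kd := key d hd
  have hk : ∑ y ∈ Sw C 48, (16 : ℤ) ≤ ∑ y ∈ Sw C 48, (O y c + O y d) := by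
    refine Finset.sum_le_sum fun y hy => ?_
    have ocd := hdisj c hc d hd hcd
    have odc := O_comm c d
    rw [mem_Sw] at hy hc hd
    have a1 := h8 y hy.1 c hc.1
    have a2 := h8 y hy.1 d hd.1
    have a3 := O_nonneg y c
    have a4 := O_nonneg y d
    have b1 := W_add y c
    have b2 := W_add y d
    have b3 := W_add (y + c) d
    have b4 := W_add (y + d) c
    have b5 := O_add_le y c d
    have b6 := O_add_le y d c
    have b7 := hW _ (C.add_mem (C.add_mem hy.1 hc.1) hd.1)
    have b8 := hW _ (C.add_mem (C.add_mem hy.1 hd.1) hc.1)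
    omega
  rw [Finset.sum_add_distrib] at hk
  simp only [Finset.sum_const, nsmul_eq_mul, h6] at hk
  linarith

/-- subcode of words vanishing on the support of c -/
def ker (C : Submodule (ZMod 2) (Fin 131 → ZMod 2)) (c : Fin 131 → ZMod 2) :
    Submodule (ZMod 2) (Fin 131 → ZMod 2) where
  carrier := {x | x ∈ C ∧ ∀ i, c i ≠ 0 → x i = 0}
  add_mem' := by
    rintro x y ⟨hx, hx'⟩ ⟨hy, hy'⟩
    exact ⟨C.add_mem hx hy, fun i hi => by rw [Pi.add_apply, hx' i hi, hy' i hi, add_zero]⟩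
  zero_mem' := ⟨C.zero_mem, fun i _ => rfl⟩
  smul_mem' := by
    rintro a x ⟨hx, hx'⟩
    exact ⟨C.smul_mem a hx, fun i hi => by rw [Pi.smul_apply, hx' i hi, smul_zero]⟩

theorem mem_ker {c x : Fin 131 → ZMod 2} : x ∈ ker C c ↔ x ∈ C ∧ O x c = 0 := by
  rw [O_eq_zero]; rfl

noncomputable def T (C : Submodule (ZMod 2) (Fin 131 → ZMod 2)) (c : Fin 131 → ZMod 2) (w o : ℤ) :
    Finset (Fin 131 → ZMod 2) := (Sw C w).filter (fun x => O x c = o)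

theorem mem_T {c x : Fin 131 → ZMod 2} {w o : ℤ} :
    x ∈ T C c w o ↔ (x ∈ C ∧ W x = w) ∧ O x c = o := by
  simp [T, mem_Sw]

attribute [irreducible] T

theorem sum_T {c : Fin 131 → ZMod 2} (w o : ℤ) (f : (Fin 131 → ZMod 2) → ℤ) :
    ∑ x ∈ T C c w o, f x = ∑ x ∈ Sw C w, if O x c = o then f x else 0 := by
  unfold T
  rw [Finset.sum_filter]

theorem sum_ker {c : Fin 131 → ZMod 2} (hc : c ∈ C) (hcw : W c = 32)
    (hWc : ∀ x ∈ C, W x = 0 ∨ W x = 32 ∨ W x = 48 ∨ W x = 64 ∨ W x = 80)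
    (f : (Fin 131 → ZMod 2) → ℤ) :
    ∑ x ∈ cs (ker C c), f x = f 0 + ∑ x ∈ T C c 32 0, f x + ∑ x ∈ T C c 48 0, f x := by
  classical
  have h : cs (ker C c) = insert 0 (T C c 32 0 ∪ T C c 48 0) := by
    ext x
    simp only [mem_cs, mem_ker, Finset.mem_insert, Finset.mem_union, mem_T]
    constructor
    · rintro ⟨hx, ho⟩
      have h1 := W_add x c
      have h2 := hWc _ (C.add_mem hx hc)
      have h3 := hWc _ hx
      have h4 : W x = 0 ∨ W x = 32 ∨ W x = 48 := by omega
      rcases h4 with h | h | h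
      · exact Or.inl (W_eq_zero h)
      · exact Or.inr (Or.inl ⟨⟨hx, h⟩, ho⟩)
      · exact Or.inr (Or.inr ⟨⟨hx, h⟩, ho⟩)
    · rintro (rfl | h | h)
      · exact ⟨C.zero_mem, O_zero c⟩
      · exact ⟨h.1.1, h.2⟩
      · exact ⟨h.1.1, h.2⟩
  rw [h, Finset.sum_insert, Finset.sum_union, add_assoc]
  · rw [Finset.disjoint_left]
    intro x hx hy
    rw [mem_T] at hx hy
    have := hx.1.2
    have := hy.1.2
    omega
  · simp only [Finset.mem_union, mem_T, W_zero]
    norm_num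

theorem case2 (h8 : ∀ x ∈ C, ∀ c ∈ C, (8 : ℤ) ∣ O x c)
    (hWc : ∀ x ∈ C, W x = 0 ∨ W x = 32 ∨ W x = 48 ∨ W x = 64 ∨ W x = 80)
    (hA : 3 * ((Sw C 32).card : ℤ) + (Sw C 48).card = 34) (hA10 : 10 ≤ (Sw C 32).card)
    (hcov : ∀ P, 3 * ∑ x ∈ Sw C 32, uu (x P) + ∑ x ∈ Sw C 48, uu (x P) ≤ 9) : False := by
  classical
  set b : Fin 131 → ℤ := fun P => 9 - (3 * ∑ x ∈ Sw C 32, uu (x P) + ∑ x ∈ Sw C 48, uu (x P)) with hb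
  have hb0 : ∀ P, 0 ≤ b P := fun P => by have := hcov P; simp only [hb]; linarith
  have hbs : ∑ P, b P = 1179 - 96 * ((Sw C 32).card : ℤ) - 48 * (Sw C 48).card := by
    simp only [hb]
    rw [Finset.sum_sub_distrib, Finset.sum_add_distrib, ← Finset.mul_sum, sum_uu_W, sum_uu_W]
    simp
    ring
  have hbr : ∑ c ∈ Sw C 32, ∑ P, uu (c P) * b P ≤ 2 * ∑ P, b P := by
    rw [Finset.sum_comm, Finset.mul_sum]
    refine Finset.sum_le_sum fun P _ => ?_
    rw [← Finset.sum_mul]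
    rcases le_or_gt (∑ x ∈ Sw C 32, uu (x P)) 2 with h | h
    · exact mul_le_mul_of_nonneg_right h (hb0 P)
    · have h2 : 0 ≤ ∑ x ∈ Sw C 48, uu (x P) := Finset.sum_nonneg fun z _ => uu_nonneg _
      have : b P = 0 := by
        have := hb0 P
        simp only [hb] at this ⊢
        omega
      rw [this]; simp
  obtain ⟨c, hc, hcb⟩ : ∃ c ∈ Sw C 32,
      ((Sw C 32).card : ℤ) * ∑ P, uu (c P) * b P ≤ 2 * ∑ P, b P := by
    by_contra! h
    have hne : (Sw C 32).Nonempty := Finset.card_pos.1 (by omega)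
    have h1 := Finset.sum_lt_sum_of_nonempty hne h
    rw [Finset.sum_const, nsmul_eq_mul, ← Finset.mul_sum] at h1
    have h2 : (0 : ℤ) < (Sw C 32).card := by omega
    have := lt_of_mul_lt_mul_left h1 h2.le
    linarith
  have hβ0 : 0 ≤ ∑ P, uu (c P) * b P := Finset.sum_nonneg fun P _ => mul_nonneg (uu_nonneg _) (hb0 P)
  have hβ : ∑ P, uu (c P) * b P =
      288 - 3 * ∑ x ∈ Sw C 32, O x c - ∑ x ∈ Sw C 48, O x c := by
    rw [← sum_uu_O, ← sum_uu_O, Finset.mul_sum]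
    have : (288 : ℤ) = ∑ P, uu (c P) * 9 := by
      rw [← Finset.sum_mul]
      change _ = W c * 9
      rw [(mem_Sw.1 hc).2]; norm_num
    rw [this, ← Finset.sum_sub_distrib, ← Finset.sum_sub_distrib]
    refine Finset.sum_congr rfl fun P _ => ?_
    simp only [hb]; ring
  have hcC := (mem_Sw.1 hc).1
  have hcw := (mem_Sw.1 hc).2
  have cardT : ∀ w o, ((T C c w o).card : ℤ) = ∑ x ∈ Sw C w, if O x c = o then 1 else 0 := by
    intro w o
    rw [← sum_T]; simp
  have ho32 : ∀ x ∈ Sw C 32, x ≠ c → O x c = 0 ∨ O x c = 8 ∨ O x c = 16 := by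
    intro x hx hne
    rw [mem_Sw] at hx
    have h1 := W_add x c
    have h2 := hWc _ (C.add_mem hx.1 hcC)
    have h3 : W (x + c) ≠ 0 := fun h => hne (add_eq_zero2 (W_eq_zero h))
    have h4 := O_nonneg x c
    have h5 := h8 x hx.1 c hcC
    omega
  have ho48 : ∀ x ∈ Sw C 48, O x c = 0 ∨ O x c = 8 ∨ O x c = 16 ∨ O x c = 24 := by
    intro x hx
    rw [mem_Sw] at hx
    have h1 := W_add x c
    have h2 := hWc _ (C.add_mem hx.1 hcC)
    have h3 : W (x + c) ≠ 0 := by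
      intro h
      have := add_eq_zero2 (W_eq_zero h)
      subst this
      have := hx.2
      omega
    have h4 := O_nonneg x c
    have h5 := h8 x hx.1 c hcC
    omega
  have e1 : ((Sw C 32).card : ℤ) = 1 + (T C c 32 0).card + (T C c 32 8).card + (T C c 32 16).card := by
    have h1 : (1 : ℤ) = ∑ x ∈ Sw C 32, if x = c then 1 else 0 := by
      rw [Finset.sum_ite_eq', if_pos hc]
    have h2 : ((Sw C 32).card : ℤ) = ∑ x ∈ Sw C 32, 1 := by simp
    have h3 : ∑ x ∈ Sw C 32, (1:ℤ) = (∑ x ∈ Sw C 32, if x = c then (1:ℤ) else 0)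
        + (T C c 32 0).card + (T C c 32 8).card + (T C c 32 16).card := by
      rw [cardT, cardT, cardT, ← Finset.sum_add_distrib, ← Finset.sum_add_distrib,
        ← Finset.sum_add_distrib]
      refine Finset.sum_congr rfl fun x hx => ?_
      by_cases e : x = c
      · subst e
        simp [O_self, hcw]
      · rcases ho32 x hx e with h | h | h <;> simp [h, e]
    linarith
  have e2 : ∑ x ∈ Sw C 32, O x c = 32 + 8 * ((T C c 32 8).card : ℤ) + 16 * (T C c 32 16).card := by
    have h1 : (32 : ℤ) = ∑ x ∈ Sw C 32, if x = c then 32 else 0 := by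
      rw [Finset.sum_ite_eq', if_pos hc]
    rw [cardT, cardT, Finset.mul_sum, Finset.mul_sum]
    nth_rewrite 2 [h1]
    rw [← Finset.sum_add_distrib, ← Finset.sum_add_distrib]
    refine Finset.sum_congr rfl fun x hx => ?_
    by_cases e : x = c
    · subst e
      simp [O_self, hcw]
    · rcases ho32 x hx e with h | h | h <;> simp [h, e]
  have e3 : ((Sw C 48).card : ℤ) = (T C c 48 0).card + (T C c 48 8).card + (T C c 48 16).card
      + (T C c 48 24).card := by
    have h2 : ((Sw C 48).card : ℤ) = ∑ x ∈ Sw C 48, 1 := by simp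
    rw [h2, cardT, cardT, cardT, cardT, ← Finset.sum_add_distrib, ← Finset.sum_add_distrib,
      ← Finset.sum_add_distrib]
    refine Finset.sum_congr rfl fun x hx => ?_
    rcases ho48 x hx with h | h | h | h <;> simp [h]
  have e4 : ∑ x ∈ Sw C 48, O x c = 8 * ((T C c 48 8).card : ℤ) + 16 * (T C c 48 16).card
      + 24 * (T C c 48 24).card := by
    rw [cardT, cardT, cardT, Finset.mul_sum, Finset.mul_sum, Finset.mul_sum,
      ← Finset.sum_add_distrib, ← Finset.sum_add_distrib]
    refine Finset.sum_congr rfl fun x hx => ?_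
    rcases ho48 x hx with h | h | h | h <;> simp [h]
  have e5 : (T C c 32 8).card = (T C c 48 24).card := by
    refine Finset.card_nbij' (fun x => x + c) (fun x => x + c) ?_ ?_ ?_ ?_
    · intro x hx
      rw [Finset.mem_coe, mem_T] at hx
      show x + c ∈ T C c 48 24
      rw [mem_T]
      have h1 := W_add x c
      have h2 := O_add_self x c
      exact ⟨⟨C.add_mem hx.1.1 hcC, by have := hx.1.2; have := hx.2; omega⟩, by have := hx.2; omega⟩
    · intro x hx
      rw [Finset.mem_coe, mem_T] at hx
      show x + c ∈ T C c 32 8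
      rw [mem_T]
      have h1 := W_add x c
      have h2 := O_add_self x c
      exact ⟨⟨C.add_mem hx.1.1 hcC, by have := hx.1.2; have := hx.2; omega⟩, by have := hx.2; omega⟩
    · intro x _; exact add_add2 x c
    · intro x _; exact add_add2 x c
  have e6 : ((cs (ker C c)).card : ℤ) = 1 + (T C c 32 0).card + (T C c 48 0).card := by
    have := sum_ker hcC hcw hWc (fun _ => 1)
    simpa using this
  obtain ⟨k, hk⟩ := card_pow (ker C c)
  have hk5 : k < 5 := by
    by_contra h
    have : 2 ^ 5 ≤ 2 ^ k := Nat.pow_le_pow_right (by norm_num) (by omega)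
    omega
  have hfin : (cs (ker C c)).card = 8 ∧ ((T C c 48 0).card = 1 ∨ (T C c 48 0).card = 2) := by
    rw [hβ] at hcb hβ0
    rw [hbs] at hcb
    have hA' : (Sw C 32).card = 10 ∨ (Sw C 32).card = 11 := by omega
    have hp : (cs (ker C c)).card = 1 ∨ (cs (ker C c)).card = 2 ∨ (cs (ker C c)).card = 4 ∨
        (cs (ker C c)).card = 8 ∨ (cs (ker C c)).card = 16 := by
      rw [hk]; interval_cases k <;> simp
    rcases hA' with h | h <;> rw [h] at hcb <;> omega
  obtain ⟨P, hP1, y, hyT, hyP⟩ : ∃ P, ∑ x ∈ T C c 48 0, uu (x P) = 1 ∧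
      ∃ y ∈ T C c 48 0, y P ≠ 0 := by
    rcases hfin.2 with h | h
    · obtain ⟨y, hy⟩ := Finset.card_eq_one.1 h
      have hyT : y ∈ T C c 48 0 := by rw [hy]; simp
      have hy0 : y ≠ 0 := by
        rintro rfl
        have := (mem_T.1 hyT).1.2
        rw [W_zero] at this
        norm_num at this
      obtain ⟨P, hP⟩ := Function.ne_iff.1 hy0
      have hP : y P ≠ 0 := hP
      refine ⟨P, ?_, y, hyT, hP⟩
      rw [hy, Finset.sum_singleton]
      unfold uu; rw [if_neg hP]
    · obtain ⟨y, z, hyz, hT⟩ := Finset.card_eq_two.1 h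
      have hyT : y ∈ T C c 48 0 := by rw [hT]; simp
      have hzT : z ∈ T C c 48 0 := by rw [hT]; simp
      have hex : ∃ P, y P ≠ 0 ∧ z P = 0 := by
        by_contra! hno
        apply hyz
        apply add_eq_zero2
        apply W_eq_zero
        have h1 : O y z = W y := by
          unfold O W
          exact Finset.sum_congr rfl fun i _ =>
            (by decide : ∀ a b : ZMod 2, (a ≠ 0 → b ≠ 0) → uu a * uu b = uu a) _ _ (hno i)
        have h2 := W_add y z
        have h3 := (mem_T.1 hyT).1.2
        have h4 := (mem_T.1 hzT).1.2
        omega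
      obtain ⟨P, hP, hP'⟩ := hex
      refine ⟨P, ?_, y, hyT, hP⟩
      rw [hT, Finset.sum_pair hyz, hP', uu_zero]
      unfold uu; rw [if_neg hP]; rfl
  have hyK : y ∈ ker C c := mem_ker.2 ⟨(mem_T.1 hyT).1.1, (mem_T.1 hyT).2⟩
  have s0 : ∑ x ∈ cs (ker C c), sg (x P) = 0 :=
    char_zero (fun x => sg (x P)) (fun x a => sg_add _ _) hyK (sg_ne _ hyP)
  have s1 : ∑ x ∈ cs (ker C c), uu (x P) = 4 := by
    simp only [sg_eq, Finset.sum_sub_distrib, ← Finset.mul_sum] at s0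
    simp only [Finset.sum_const, nsmul_eq_mul, hfin.1] at s0
    push_cast at s0
    linarith
  rw [sum_ker hcC hcw hWc (fun x => uu (x P)), hP1] at s1
  simp only [Pi.zero_apply, uu_zero] at s1
  have sub : ∀ w, ∑ x ∈ T C c w 0, uu (x P) ≤ ∑ x ∈ Sw C w, uu (x P) := by
    intro w
    refine Finset.sum_le_sum_of_subset_of_nonneg ?_ fun z _ _ => uu_nonneg _
    intro x hx
    exact mem_Sw.2 (mem_T.1 hx).1
  have t1 := sub 32
  have t2 := sub 48
  have := hcov P
  linarith

theorem no32 (heff : ∀ i : Fin 131, ∃ c ∈ C, c i ≠ 0)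
    (hproj : ∀ i j : Fin 131, i ≠ j → ∃ c ∈ C, c i ≠ c j)
    (hdiv : ∀ c ∈ C, 16 ∣ hwt c) {c} (hc : c ∈ C) : W c ≠ 32 := by
  intro hw
  have hn : ∀ x ∈ C, W x ≠ 16 := fun x hx => no16 heff hproj hdiv hx
  have hWc : ∀ x ∈ C, W x = 0 ∨ W x = 32 ∨ W x = 48 ∨ W x = 64 ∨ W x = 80 := by
    intro x hx
    have := W_cases heff hproj hdiv hx
    have := hn x hx
    omega
  have h8 : ∀ x ∈ C, ∀ c ∈ C, (8 : ℤ) ∣ O x c := fun x hx c hc => O8 hdiv hx hc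
  have h1 := sum_F heff hproj hdiv
  have h2 := sum_G heff hproj hdiv
  have h3 : ∀ P, 2048 * (3 * ∑ x ∈ Sw C 32, uu (x P) + ∑ x ∈ Sw C 48, uu (x P)) ≤ 9 * NN C := by
    intro P
    have := cover heff hproj hdiv P
    rw [decomp hn (fun x => uu (x P))] at this
    simp only [Pi.zero_apply, uu_zero] at this
    linarith
  have h4 : ∑ x ∈ cs C, FF x = 10 + 3 * ((Sw C 32).card : ℤ) + (Sw C 48).card := by
    have := decomp hn (fun _ => 1)
    simpa using this
  rw [h4] at h1
  rw [sumG hn] at h2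
  have hA1 : 1 ≤ (Sw C 32).card := Finset.card_pos.2 ⟨c, mem_Sw.2 ⟨hc, hw⟩⟩
  have h5 : 2048 * (96 * ((Sw C 32).card : ℤ)) ≤ 1179 * NN C := by
    have h := Finset.sum_le_sum (s := Finset.univ) fun P _ => h3 P
    rw [← Finset.mul_sum, Finset.sum_add_distrib, ← Finset.mul_sum, sum_uu_W, sum_uu_W] at h
    simp at h
    have : (0 : ℤ) ≤ (Sw C 48).card := by positivity
    linarith
  obtain ⟨k, hk⟩ := card_pow C
  have hN : NN C = 2 ^ k := by unfold NN; rw [hk]; norm_cast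
  have hl : 513 ≤ NN C := by omega
  have hu : NN C ≤ 4095 := by omega
  rw [hN] at hl hu
  have k1 : k < 12 := by
    by_contra h
    have : (2 : ℤ) ^ 12 ≤ 2 ^ k := pow_le_pow_right₀ (by norm_num) (by omega)
    norm_num at this; linarith
  have k2 : 9 < k := by
    by_contra h
    have : (2 : ℤ) ^ k ≤ 2 ^ 9 := pow_le_pow_right₀ (by norm_num) (by omega)
    norm_num at this; linarith
  have k3 : k = 10 ∨ k = 11 := by omega
  rcases k3 with rfl | rfl
  · norm_num at hN
    rw [hN] at h1 h2 h3
    refine case1 (C := C) (fun x hx => W_le heff hproj hdiv hx) h8 (by omega) fun P => ?_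
    have := h3 P
    omega
  · norm_num at hN
    rw [hN] at h1 h2 h3
    refine case2 (C := C) h8 hWc (by omega) (by omega) fun P => ?_
    have := h3 P
    omega

end

/-- A projective 16-divisible binary linear code of effective length 131 does not
contain a codeword of Hamming weight 16 or 32. -/
theorem no_weight_16_or_32 (C : Submodule (ZMod 2) (Fin 131 → ZMod 2))
    (heff : ∀ i : Fin 131, ∃ c ∈ C, c i ≠ 0)
    (hproj : ∀ i j : Fin 131, i ≠ j → ∃ c ∈ C, c i ≠ c j)
    (hdiv : ∀ c ∈ C, 16 ∣ hwt c) :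
    ∀ c ∈ C, hwt c ≠ 16 ∧ hwt c ≠ 32 := by
  intro c hc
  have h1 := no16 heff hproj hdiv hc
  have h2 := no32 heff hproj hdiv hc
  rw [← hwt_eq] at h1 h2
  exact ⟨by exact_mod_cast h1, by exact_mod_cast h2⟩
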